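/- Fix β ∈ ℝ and s > 0. Let f = (f₀,f₁,f₂,f₃) and a = (a₀,a₁,a₂,a₃) in ℝ⁴ with f₀ ≠ 0, a₀ ≠ 0 and equal Mumford slopes f₁/f₀ = a₁/a₀ =: μ. Then as α → +∞, α²·(λ_{α,β,s}(f) − λ_{α,β,s}(a)) converges to (4/(f₀·a₀))·( (s+1/6)·(μ − β)·δ₂₀^β(f,a) − (1/2)·δ₃₀^β(f,a) ). -/

import Mathlib

open Filter Topology

/-- The β-twisted Chern character of `v = (v₀,v₁,v₂,v₃)`. -/
noncomputable def chB (β : ℝ) (v : Fin 4 → ℝ) : Fin 4 → ℝ :=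
  ![v 0, v 1 - β * v 0, v 2 - β * v 1 + β ^ 2 / 2 * v 0,
    v 3 - β * v 2 + β ^ 2 / 2 * v 1 - β ^ 3 / 6 * v 0]

/-- The Bridgeland slope `λ_{α,β,s}(v)`. -/
noncomputable def bslope (α β s : ℝ) (v : Fin 4 → ℝ) : ℝ :=
  (chB β v 3 - (s + 1 / 6) * α ^ 2 * chB β v 1) / (chB β v 2 - α ^ 2 / 2 * v 0)

/-- `δ_{ij}^β(f,a) = ch_i^β(f)·ch_j^β(a) − ch_j^β(f)·ch_i^β(a)`. -/
noncomputable def deltaB (i j : Fin 4) (β : ℝ) (f a : Fin 4 → ℝ) : ℝ :=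
  chB β f i * chB β a j - chB β f j * chB β a i

/-- As `α → ∞`, the slope `λ_{α,β,s}(v)` tends to `2(s+1/6)(μ−β)`, with an explicit leading
error term of order `α⁻²`. -/
theorem alpha_sq_mul_bslope_sub_const_tendsto (β s : ℝ) (v : Fin 4 → ℝ) (hv : v 0 ≠ 0) :
    Tendsto (fun α : ℝ => α ^ 2 * (bslope α β s v - 2 * (s + 1 / 6) * (v 1 / v 0 - β))) atTop
      (𝓝 (-2 * (chB β v 3 - 2 * (s + 1 / 6) * (v 1 / v 0 - β) * chB β v 2) / v 0)) := by
  have hinv : Tendsto (fun α : ℝ => (α ^ 2)⁻¹) atTop (𝓝 0) :=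
    tendsto_inv_atTop_zero.comp (tendsto_pow_atTop two_ne_zero)
  have hden : Tendsto (fun α : ℝ => chB β v 2 * (α ^ 2)⁻¹ - v 0 / 2) atTop (𝓝 (-(v 0 / 2))) := by
    simpa using (hinv.const_mul (chB β v 2)).sub_const (v 0 / 2)
  have hlim : -(v 0 / 2) ≠ 0 := neg_ne_zero.mpr (div_ne_zero hv two_ne_zero)
  have h := (tendsto_const_nhds (x := chB β v 3 -
    2 * (s + 1 / 6) * (v 1 / v 0 - β) * chB β v 2)).div hden hlim
  have heq : -2 * (chB β v 3 - 2 * (s + 1 / 6) * (v 1 / v 0 - β) * chB β v 2) / v 0 =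
      (chB β v 3 - 2 * (s + 1 / 6) * (v 1 / v 0 - β) * chB β v 2) / -(v 0 / 2) := by
    field_simp
  rw [heq]
  refine h.congr' ?_
  filter_upwards [eventually_gt_atTop 0, hden.eventually_ne hlim] with α hα hne
  have hα' : α ^ 2 ≠ 0 := (pow_pos hα 2).ne'
  have hfactor : chB β v 2 - α ^ 2 / 2 * v 0 = α ^ 2 * (chB β v 2 * (α ^ 2)⁻¹ - v 0 / 2) := by
    field_simp
  have hch : chB β v 1 = (v 1 / v 0 - β) * v 0 := by
    simp only [chB, Matrix.cons_val]
    field_simp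
  have hne' : chB β v 2 - α ^ 2 / 2 * v 0 ≠ 0 := hfactor ▸ mul_ne_zero hα' hne
  have hquot : chB β v 2 * (α ^ 2)⁻¹ - v 0 / 2 = (chB β v 2 - α ^ 2 / 2 * v 0) / α ^ 2 := by
    rw [hfactor, mul_div_cancel_left₀ _ hα']
  rw [Pi.div_apply, hquot, bslope, hch, div_sub' hne', div_div_eq_mul_div, mul_div_assoc']
  ring

/-- for `f, a` of nonzero rank and equal Mumford slope `μ`,
`α²·(λ(f) − λ(a)) → (4/(f₀a₀))·((s+1/6)(μ−β)δ₂₀^β(f,a) − (1/2)δ₃₀^β(f,a))`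
as `α → ∞`. -/
theorem alpha_sq_mul_bslope_sub_tendsto (β s : ℝ) (hs : 0 < s) (f a : Fin 4 → ℝ)
    (hf : f 0 ≠ 0) (ha : a 0 ≠ 0) (hμ : f 1 / f 0 = a 1 / a 0) :
    Tendsto (fun α : ℝ => α ^ 2 * (bslope α β s f - bslope α β s a)) atTop
      (𝓝 (4 / (f 0 * a 0) *
        ((s + 1 / 6) * (a 1 / a 0 - β) * deltaB 2 0 β f a
          - 1 / 2 * deltaB 3 0 β f a))) := by
  have hsub := (alpha_sq_mul_bslope_sub_const_tendsto β s f hf).sub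
    (alpha_sq_mul_bslope_sub_const_tendsto β s a ha)
  rw [hμ] at hsub
  convert hsub using 2
  · ring
  · have hf₀ : chB β f 0 = f 0 := rfl
    have ha₀ : chB β a 0 = a 0 := rfl
    simp only [deltaB, hf₀, ha₀]
    generalize a 1 / a 0 = μ
    field_simp
    ring
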